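/- For all real $X \ge 2$, the mean square of the remainder $T(x^2) = \sum_{0 \le m \le x^2} r_2(m)\,\psi\big((x^4 - m^2)^{1/2}\big)$ satisfies $\frac{1}{X}\int_X^{2X} T(x^2)^2\,dx \ll X^2 (\log X)^4$. -/

import Mathlib

open scoped BigOperators

noncomputable def r2 (n : ℕ) : ℕ :=
  Nat.card {p : ℤ × ℤ // p.1 ^ 2 + p.2 ^ 2 = (n : ℤ)}

/-- The sawtooth function. -/
noncomputable def sawtooth (t : ℝ) : ℝ := t - ⌊t⌋ - 1 / 2

/-- The remainder term `T(Y)`. -/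
noncomputable def T (Y : ℝ) : ℝ :=
  ∑ m ∈ Finset.Iic ⌊Y⌋₊, (r2 m : ℝ) * sawtooth (Real.sqrt (Y ^ 2 - (m : ℝ) ^ 2))

open Set MeasureTheory Real

/-- First-derivative test: if `F` has derivative `1 / w` with `w` nonnegative and nondecreasing, then the
oscillatory integral of `cos ∘ F` is at most `2 * w b`. -/
lemma abs_integral_cos_le {a b : ℝ} (hab : a ≤ b) {F w F' : ℝ → ℝ}
    (hFc : ContinuousOn F (Icc a b)) (hwc : ContinuousOn w (Icc a b))
    (hw : MonotoneOn w (Icc a b)) (hw0 : 0 ≤ w a)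
    (hF : ∀ x ∈ Ioo a b, HasDerivAt F (F' x) x) (hwd : ∀ x ∈ Ioo a b, DifferentiableAt ℝ w x)
    (hwF : ∀ x ∈ Ioo a b, w x * F' x = 1) :
    |∫ x in a..b, cos (F x)| ≤ 2 * w b := by
  have hderiv_nonneg : ∀ x ∈ Ioo a b, 0 ≤ deriv w x := by
    intro x hx
    have hnhds : Icc a b ∈ nhds x := Icc_mem_nhds hx.1 hx.2
    have := hw.derivWithin_nonneg (x := x)
    rwa [derivWithin_of_mem_nhds hnhds] at this
  have hint : IntegrableOn (fun x => cos (F x)) (Icc a b) :=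
    (continuous_cos.comp_continuousOn hFc).integrableOn_Icc
  have hG : ∀ x ∈ Ioo a b, HasDerivAt (fun x => w x * sin (F x))
      (deriv w x * sin (F x) + cos (F x)) x := by
    intro x hx
    refine ((hwd x hx).hasDerivAt.mul (hF x hx).sin).congr_deriv ?_
    linear_combination cos (F x) * hwF x hx
  have hGc : ContinuousOn (fun x => w x * sin (F x)) (Icc a b) :=
    hwc.mul (continuous_sin.comp_continuousOn hFc)
  have hupper := intervalIntegral.integral_le_sub_of_hasDeriv_right_of_le hab (hGc.add hwc)
    (fun x hx => ((hG x hx).add (hwd x hx).hasDerivAt).hasDerivWithinAt) hint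
    (fun x hx => by nlinarith [hderiv_nonneg x hx, neg_one_le_sin (F x)])
  have hlower := intervalIntegral.sub_le_integral_of_hasDeriv_right_of_le hab (hGc.sub hwc)
    (fun x hx => ((hG x hx).sub (hwd x hx).hasDerivAt).hasDerivWithinAt) hint
    (fun x hx => by nlinarith [hderiv_nonneg x hx, sin_le_one (F x)])
  have hwab : w a ≤ w b := hw (left_mem_Icc.2 hab) (right_mem_Icc.2 hab) hab
  simp only [Pi.add_apply, Pi.sub_apply] at hupper hlower
  rw [abs_le]
  constructor
  · nlinarith [sin_le_one (F a), neg_one_le_sin (F b)]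
  · nlinarith [neg_one_le_sin (F a), sin_le_one (F b)]

lemma hasDerivAt_sqrt_sq_sq_sub_sq {x k : ℝ} (h : 0 < (x ^ 2) ^ 2 - k ^ 2) :
    HasDerivAt (fun x : ℝ => √((x ^ 2) ^ 2 - k ^ 2)) (2 * x ^ 3 / √((x ^ 2) ^ 2 - k ^ 2)) x := by
  have hpoly : HasDerivAt (fun x : ℝ => (x ^ 2) ^ 2 - k ^ 2) (4 * x ^ 3) x := by
    refine (((hasDerivAt_pow 2 x).fun_pow 2).sub_const (k ^ 2)).congr_deriv ?_
    push_cast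
    ring
  refine (hpoly.sqrt h.ne').congr_deriv ?_
  ring

/-- The oscillatory integral attached to a pair `n < m` of frequencies. -/
lemma abs_integral_cos_sqrt_sub_sqrt_le {a b c m n : ℝ} (ha : 0 < a) (hab : a ≤ b) (hc : 0 < c)
    (hn : 0 ≤ n) (hnm : n < m) (hma : m ≤ a ^ 2) :
    |∫ x in a..b, cos (c * (√((x ^ 2) ^ 2 - m ^ 2) - √((x ^ 2) ^ 2 - n ^ 2)))| ≤
      2 * (b ^ 3 / (c * (m ^ 2 - n ^ 2))) := by
  have hmn : 0 < m ^ 2 - n ^ 2 := by nlinarith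
  have hsub : ∀ x ∈ Icc a b, ∀ k, 0 ≤ k → k ≤ m → 0 ≤ (x ^ 2) ^ 2 - k ^ 2 := by
    intro x hx k hk hkm
    have : a ^ 2 ≤ x ^ 2 := pow_le_pow_left₀ ha.le hx.1 2
    nlinarith
  have hsub' : ∀ x ∈ Ioo a b, ∀ k, 0 ≤ k → k ≤ m → 0 < (x ^ 2) ^ 2 - k ^ 2 := by
    intro x hx k hk hkm
    have : a ^ 2 < x ^ 2 := pow_lt_pow_left₀ hx.1 ha.le two_ne_zero
    nlinarith
  have hquot : ∀ k, 0 ≤ k → k ≤ m → MonotoneOn (fun x => √((x ^ 2) ^ 2 - k ^ 2) / x) (Icc a b) := by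
    intro k hk hkm x hx y hy hxy
    have hx0 : 0 < x := ha.trans_le hx.1
    have hy0 : 0 < y := ha.trans_le hy.1
    have h1 := hsub x hx k hk hkm
    have h2 := hsub y hy k hk hkm
    have hxy2 : x ^ 2 ≤ y ^ 2 := pow_le_pow_left₀ hx0.le hxy 2
    simp only
    rw [div_le_div_iff₀ hx0 hy0]
    refine le_of_sq_le_sq ?_ (by positivity)
    rw [mul_pow, mul_pow, sq_sqrt h1, sq_sqrt h2]
    have : 0 ≤ (y ^ 2 - x ^ 2) * (x ^ 2 * y ^ 2 + k ^ 2) :=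
      mul_nonneg (by linarith) (by positivity)
    nlinarith
  set A : ℝ → ℝ := fun x => √((x ^ 2) ^ 2 - m ^ 2) with hA
  set B : ℝ → ℝ := fun x => √((x ^ 2) ^ 2 - n ^ 2) with hB
  have hAq := hquot m (hn.trans hnm.le) le_rfl
  have hBq := hquot n hn hnm.le
  have hnonneg : ∀ g : ℝ → ℝ, (∀ x, 0 ≤ g x) → ∀ x ∈ Icc a b, 0 ≤ g x / x := fun g hg x hx =>
    div_nonneg (hg x) (ha.le.trans hx.1)
  have hA0 : ∀ x, 0 ≤ A x := fun x => sqrt_nonneg _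
  have hB0 : ∀ x, 0 ≤ B x := fun x => sqrt_nonneg _
  set w : ℝ → ℝ := fun x =>
    (2 * c * (m ^ 2 - n ^ 2))⁻¹ * ((A x / x) * (B x / x) * (A x / x + B x / x)) with hw
  have hAc : Continuous A := by fun_prop
  have hBc : Continuous B := by fun_prop
  have hne : ∀ x ∈ Icc a b, x ≠ 0 := fun x hx => (ha.trans_le hx.1).ne'
  have hAd : ∀ x ∈ Ioo a b, HasDerivAt A (2 * x ^ 3 / A x) x := fun x hx =>
    hasDerivAt_sqrt_sq_sq_sub_sq (hsub' x hx m (hn.trans hnm.le) le_rfl)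
  have hBd : ∀ x ∈ Ioo a b, HasDerivAt B (2 * x ^ 3 / B x) x := fun x hx =>
    hasDerivAt_sqrt_sq_sq_sub_sq (hsub' x hx n hn hnm.le)
  have hmono : MonotoneOn w (Icc a b) := by
    have h1 : MonotoneOn (fun x => (A x / x) * (B x / x) * (A x / x + B x / x)) (Icc a b) :=
      (hAq.mul hBq (hnonneg A hA0) (hnonneg B hB0)).mul (hAq.add hBq)
        (fun x hx => mul_nonneg (hnonneg A hA0 x hx) (hnonneg B hB0 x hx))
        (fun x hx => add_nonneg (hnonneg A hA0 x hx) (hnonneg B hB0 x hx))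
    intro x hx y hy hxy
    exact mul_le_mul_of_nonneg_left (h1 hx hy hxy) (by positivity)
  have key := abs_integral_cos_le hab (F := fun x => c * (A x - B x)) (w := w)
    (F' := fun x => c * (2 * x ^ 3 / A x - 2 * x ^ 3 / B x)) (by fun_prop)
    (continuousOn_const.mul (((hAc.continuousOn.div continuousOn_id hne).mul
      (hBc.continuousOn.div continuousOn_id hne)).mul ((hAc.continuousOn.div continuousOn_id hne).add
      (hBc.continuousOn.div continuousOn_id hne))))
    hmono ?_ ?_ ?_ ?_
  · refine key.trans ?_
    have hb : b ∈ Icc a b := right_mem_Icc.2 hab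
    have hb0 : 0 < b := ha.trans_le hab
    have hle : ∀ k, √((b ^ 2) ^ 2 - k ^ 2) / b ≤ b := by
      intro k
      rw [div_le_iff₀ hb0, sqrt_le_left (by positivity)]
      nlinarith [sq_nonneg k]
    have h1 : (A b / b) * (B b / b) * (A b / b + B b / b) ≤ b * b * (b + b) := by
      have := hnonneg A hA0 b hb
      have := hnonneg B hB0 b hb
      have := hle m
      have := hle n
      gcongr
    have h2 : w b ≤ (2 * c * (m ^ 2 - n ^ 2))⁻¹ * (b * b * (b + b)) :=
      mul_le_mul_of_nonneg_left h1 (by positivity)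
    have h3 : (2 * c * (m ^ 2 - n ^ 2))⁻¹ * (b * b * (b + b)) = b ^ 3 / (c * (m ^ 2 - n ^ 2)) := by
      field_simp
      ring
    linarith
  · have := hnonneg A hA0 a (left_mem_Icc.2 hab)
    have := hnonneg B hB0 a (left_mem_Icc.2 hab)
    simp only [hw]
    positivity
  · intro x hx
    exact ((hAd x hx).sub (hBd x hx)).const_mul c
  · intro x hx
    have := (hAd x hx).differentiableAt
    have := (hBd x hx).differentiableAt
    have := hne x (Ioo_subset_Icc_self hx)
    fun_prop (disch := assumption)
  · intro x hx
    have hx0 := hne x (Ioo_subset_Icc_self hx)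
    have hm0 := hsub' x hx m (hn.trans hnm.le) le_rfl
    have hn0 := hsub' x hx n hn hnm.le
    have hAx : A x ≠ 0 := (sqrt_pos.2 hm0).ne'
    have hBx : B x ≠ 0 := (sqrt_pos.2 hn0).ne'
    have hA2 : A x ^ 2 = (x ^ 2) ^ 2 - m ^ 2 := sq_sqrt hm0.le
    have hB2 : B x ^ 2 = (x ^ 2) ^ 2 - n ^ 2 := sq_sqrt hn0.le
    have hdiff : m ^ 2 - n ^ 2 = B x ^ 2 - A x ^ 2 := by rw [hA2, hB2]; ring
    simp only [hw]
    have h4 := hmn.ne'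
    rw [hdiff] at h4 ⊢
    field_simp
    ring

/-- The difference between the sawtooth function and its truncated Fourier series. -/
noncomputable def sawtoothTail (H : ℕ) (t : ℝ) : ℝ :=
  sawtooth t + ∑ h ∈ Finset.Icc 1 H, sin (2 * π * h * t) / (π * h)

lemma sawtooth_eq_fract_sub (t : ℝ) : sawtooth t = Int.fract t - 1 / 2 := rfl

lemma periodic_sawtoothTail (H : ℕ) : Function.Periodic (sawtoothTail H) 1 := by
  intro t
  unfold sawtoothTail
  rw [sawtooth_eq_fract_sub, sawtooth_eq_fract_sub, Int.fract_add_one]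
  congr 1
  refine Finset.sum_congr rfl fun h _ => ?_
  rw [show 2 * π * h * (t + 1) = 2 * π * h * t + h * (2 * π) by ring, sin_add_nat_mul_two_pi]

lemma measurable_sawtoothTail (H : ℕ) : Measurable (sawtoothTail H) := by
  have h1 : Measurable sawtooth := measurable_fract.sub_const _
  have h2 : Measurable fun t : ℝ => ∑ h ∈ Finset.Icc 1 H, sin (2 * π * h * t) / (π * h) :=
    Continuous.measurable (by fun_prop)
  exact h1.add h2

lemma exists_abs_sawtoothTail_le (H : ℕ) : ∃ B, ∀ t, |sawtoothTail H t| ≤ B := by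
  refine ⟨1 + ∑ h ∈ Finset.Icc 1 H, 1 / (π * h), fun t => (abs_add_le _ _).trans ?_⟩
  gcongr
  · rw [sawtooth_eq_fract_sub, abs_le]
    constructor <;> linarith [Int.fract_nonneg t, Int.fract_lt_one t]
  · refine (Finset.abs_sum_le_sum_abs _ _).trans (Finset.sum_le_sum fun h _ => ?_)
    rw [abs_div, abs_of_nonneg (by positivity : 0 ≤ π * h)]
    gcongr
    exact abs_sin_le_one _

lemma integral_cos_two_pi_int_mul (j : ℤ) (hj : j ≠ 0) :
    ∫ t in (0 : ℝ)..1, cos (2 * π * j * t) = 0 := by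
  have hne : 2 * π * (j : ℝ) ≠ 0 := by positivity
  rw [intervalIntegral.integral_comp_mul_left (fun t => cos t) hne, integral_cos]
  have hsin : sin (2 * π * j) = 0 := by
    simpa [mul_comm] using sin_add_int_mul_two_pi 0 j
  simp [hsin]

lemma integral_sin_mul_sin_two_pi (h k : ℕ) (hh : h ≠ 0) :
    ∫ t in (0 : ℝ)..1, sin (2 * π * h * t) * sin (2 * π * k * t) = if h = k then 1 / 2 else 0 := by
  have hprod : ∀ t : ℝ, sin (2 * π * h * t) * sin (2 * π * k * t) =
      1 / 2 * cos (2 * π * ((h - k : ℤ) : ℝ) * t) - 1 / 2 * cos (2 * π * ((h + k : ℤ) : ℝ) * t) := by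
    intro t
    push_cast
    rw [show 2 * π * ((h : ℝ) - k) * t = 2 * π * h * t - 2 * π * k * t by ring,
      show 2 * π * ((h : ℝ) + k) * t = 2 * π * h * t + 2 * π * k * t by ring, cos_sub, cos_add]
    ring
  simp_rw [hprod]
  rw [intervalIntegral.integral_sub (Continuous.intervalIntegrable (by fun_prop) _ _)
    (Continuous.intervalIntegrable (by fun_prop) _ _), intervalIntegral.integral_const_mul,
    intervalIntegral.integral_const_mul, integral_cos_two_pi_int_mul (h + k) (by omega)]
  split_ifs with heq
  · simp [heq]
  · rw [integral_cos_two_pi_int_mul _ (by omega)]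
    simp

lemma integral_sub_half_mul_sin_two_pi (h : ℕ) (hh : h ≠ 0) :
    ∫ t in (0 : ℝ)..1, (t - 1 / 2) * sin (2 * π * h * t) = -(1 / (2 * π * h)) := by
  set a : ℝ := 2 * π * h with ha
  have ha0 : a ≠ 0 := by positivity
  have hderiv : ∀ t ∈ uIcc (0 : ℝ) 1,
      HasDerivAt (fun t => -((t - 1 / 2) * cos (a * t)) / a + sin (a * t) / a ^ 2)
        ((t - 1 / 2) * sin (a * t)) t := by
    intro t _
    have hlin : HasDerivAt (fun t => a * t) a t := by simpa using (hasDerivAt_id t).const_mul a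
    refine (((((hasDerivAt_id t).sub_const (1 / 2)).mul hlin.cos).neg.div_const a).add
      (hlin.sin.div_const (a ^ 2))).congr_deriv ?_
    simp only [id_eq]
    field_simp
    ring
  rw [intervalIntegral.integral_eq_sub_of_hasDerivAt hderiv
    (Continuous.intervalIntegrable (by fun_prop) _ _)]
  have hcos : cos a = 1 := by rw [ha, mul_comm, cos_nat_mul_two_pi]
  have hsin : sin a = 0 := by
    have := sin_add_nat_mul_two_pi 0 h
    rwa [zero_add, sin_zero, mul_comm] at this
  simp only [mul_one, mul_zero, cos_zero, sin_zero, hcos, hsin]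
  field_simp
  ring

lemma pi_sq_div_six_sub_sum_le {H : ℕ} (hH : H ≠ 0) :
    π ^ 2 / 6 - ∑ h ∈ Finset.Icc 1 H, ((h : ℝ) ^ 2)⁻¹ ≤ (H : ℝ)⁻¹ := by
  rw [sub_le_iff_le_add]
  refine hasSum_le_of_sum_le hasSum_zeta_two fun s => ?_
  obtain ⟨n, hn⟩ : ∃ n, s ⊆ Finset.range n := s.exists_nat_subset_range
  have hsub : s \ {0} ⊆ Finset.Icc 1 H ∪ Finset.Ioc H (max n H) := by
    intro i hi
    simp only [Finset.mem_sdiff, Finset.mem_singleton, Finset.mem_union, Finset.mem_Icc,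
      Finset.mem_Ioc] at hi ⊢
    have := Finset.mem_range.1 (hn hi.1)
    omega
  calc ∑ i ∈ s, 1 / (i : ℝ) ^ 2 = ∑ i ∈ s \ {0}, ((i : ℝ) ^ 2)⁻¹ := by
        simp_rw [one_div]
        refine (Finset.sum_subset Finset.sdiff_subset fun i hi hi' => ?_).symm
        have : i = 0 := by simpa [hi] using hi'
        simp [this]
    _ ≤ ∑ i ∈ Finset.Icc 1 H ∪ Finset.Ioc H (max n H), ((i : ℝ) ^ 2)⁻¹ :=
        Finset.sum_le_sum_of_subset_of_nonneg hsub fun i _ _ => by positivity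
    _ = ∑ i ∈ Finset.Icc 1 H, ((i : ℝ) ^ 2)⁻¹ + ∑ i ∈ Finset.Ioc H (max n H), ((i : ℝ) ^ 2)⁻¹ := by
        refine Finset.sum_union (Finset.disjoint_left.2 fun i hi hi' => ?_)
        simp only [Finset.mem_Icc, Finset.mem_Ioc] at hi hi'
        omega
    _ ≤ (H : ℝ)⁻¹ + ∑ h ∈ Finset.Icc 1 H, ((h : ℝ) ^ 2)⁻¹ := by
        have h1 := sum_Ioc_inv_sq_le_sub (α := ℝ) hH (le_max_right n H)
        have h2 : (0 : ℝ) ≤ ((max n H : ℕ) : ℝ)⁻¹ := by positivity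
        linarith

/-- The mean square of the truncation error of the Fourier series of the sawtooth function. -/
lemma integral_sawtoothTail_sq_le {H : ℕ} (hH : H ≠ 0) :
    ∫ t in (0 : ℝ)..1, sawtoothTail H t ^ 2 ≤ (H : ℝ)⁻¹ := by
  set S : ℝ → ℝ := fun t => ∑ h ∈ Finset.Icc 1 H, sin (2 * π * h * t) / (π * h) with hS
  have hSc : Continuous S := by fun_prop
  have hcongr : ∫ t in (0 : ℝ)..1, sawtoothTail H t ^ 2 =
      ∫ t in (0 : ℝ)..1, ((t - 1 / 2) ^ 2 + 2 * ((t - 1 / 2) * S t) + S t * S t) := by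
    rw [intervalIntegral.integral_of_le zero_le_one, intervalIntegral.integral_of_le zero_le_one,
      integral_Ioc_eq_integral_Ioo, integral_Ioc_eq_integral_Ioo]
    refine setIntegral_congr_fun measurableSet_Ioo fun t ht => ?_
    simp only [sawtoothTail, sawtooth_eq_fract_sub, Int.fract_eq_self.2 ⟨ht.1.le, ht.2⟩, hS]
    ring
  have h1 : ∫ t in (0 : ℝ)..1, (t - 1 / 2) ^ 2 = 1 / 12 := by
    rw [intervalIntegral.integral_comp_sub_right (fun t => t ^ 2), integral_pow]
    norm_num
  have h2 : ∫ t in (0 : ℝ)..1, (t - 1 / 2) * S t =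
      -(∑ h ∈ Finset.Icc 1 H, ((h : ℝ) ^ 2)⁻¹) / (2 * π ^ 2) := by
    simp only [hS, Finset.mul_sum]
    rw [intervalIntegral.integral_finsetSum fun h _ =>
      Continuous.intervalIntegrable (by fun_prop) _ _, ← Finset.sum_neg_distrib, Finset.sum_div]
    refine Finset.sum_congr rfl fun h hh => ?_
    have h0 : h ≠ 0 := by have := (Finset.mem_Icc.1 hh).1; omega
    simp_rw [← mul_div_assoc]
    rw [intervalIntegral.integral_div, integral_sub_half_mul_sin_two_pi h h0]
    field_simp
  have h3 : ∫ t in (0 : ℝ)..1, S t * S t =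
      (∑ h ∈ Finset.Icc 1 H, ((h : ℝ) ^ 2)⁻¹) / (2 * π ^ 2) := by
    simp only [hS, Finset.sum_mul_sum]
    rw [intervalIntegral.integral_finsetSum fun h _ =>
      Continuous.intervalIntegrable (by fun_prop) _ _, Finset.sum_div]
    refine Finset.sum_congr rfl fun h hh => ?_
    have h0 : h ≠ 0 := by have := (Finset.mem_Icc.1 hh).1; omega
    rw [intervalIntegral.integral_finsetSum fun k _ =>
      Continuous.intervalIntegrable (by fun_prop) _ _]
    simp_rw [div_mul_div_comm, intervalIntegral.integral_div, integral_sin_mul_sin_two_pi h _ h0,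
      ite_div, zero_div]
    rw [Finset.sum_ite_eq, if_pos hh]
    field_simp
  rw [hcongr, intervalIntegral.integral_add (Continuous.intervalIntegrable (by fun_prop) _ _)
    (Continuous.intervalIntegrable (by fun_prop) _ _),
    intervalIntegral.integral_add (Continuous.intervalIntegrable (by fun_prop) _ _)
    (Continuous.intervalIntegrable (by fun_prop) _ _), intervalIntegral.integral_const_mul,
    h1, h2, h3]
  have htail := pi_sq_div_six_sub_sum_le hH
  set Z := ∑ h ∈ Finset.Icc 1 H, ((h : ℝ) ^ 2)⁻¹
  have hval : 1 / 12 + 2 * (-Z / (2 * π ^ 2)) + Z / (2 * π ^ 2) =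
      (π ^ 2 / 6 - Z) / (2 * π ^ 2) := by
    field_simp
    ring
  have hpi : 1 ≤ 2 * π ^ 2 := by nlinarith [pi_gt_three]
  rw [hval, div_le_iff₀ (by positivity)]
  nlinarith [inv_nonneg.2 (Nat.cast_nonneg (α := ℝ) H)]

/-- Transfer of the mean of a nonnegative `1`-periodic function along `x ↦ √(x⁴ - m²)`. -/
lemma integral_periodic_comp_sqrt_le {g : ℝ → ℝ} (hg : Function.Periodic g 1)
    (hg0 : ∀ t, 0 ≤ g t) (hgi : ∀ u v, IntervalIntegrable g volume u v) {a b m : ℝ} (ha : 1 ≤ a)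
    (hab : a ≤ b) (hm : 0 ≤ m) (hma : m ≤ a ^ 2) :
    ∫ x in a..b, g (√((x ^ 2) ^ 2 - m ^ 2)) ≤ ⌈b ^ 2⌉₊ * ∫ t in (0 : ℝ)..1, g t := by
  set φ : ℝ → ℝ := fun x => √((x ^ 2) ^ 2 - m ^ 2) with hφ
  set φ' : ℝ → ℝ := fun x => 2 * x ^ 3 / √((x ^ 2) ^ 2 - m ^ 2) with hφ'
  have hpos : ∀ x ∈ Ioo a b, 0 < (x ^ 2) ^ 2 - m ^ 2 := by
    intro x hx
    have : a ^ 2 < x ^ 2 := pow_lt_pow_left₀ hx.1 (by linarith) two_ne_zero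
    nlinarith
  have hderiv : ∀ x ∈ Ioo a b, HasDerivWithinAt φ (φ' x) (Ioo a b) x := fun x hx =>
    (hasDerivAt_sqrt_sq_sq_sub_sq (hpos x hx)).hasDerivWithinAt
  have hinj : InjOn φ (Ioo a b) := by
    refine StrictMonoOn.injOn fun x hx y hy hxy => sqrt_lt_sqrt (hpos x hx).le ?_
    have : x ^ 2 < y ^ 2 := pow_lt_pow_left₀ hxy (by linarith [hx.1]) two_ne_zero
    nlinarith [sq_nonneg x]
  have hφ'1 : ∀ x ∈ Ioo a b, 1 ≤ |φ' x| := by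
    intro x hx
    have hx1 : 1 ≤ x := ha.trans hx.1.le
    have hs := sqrt_pos.2 (hpos x hx)
    rw [abs_of_pos (by positivity), hφ', le_div_iff₀ hs, one_mul, sqrt_le_left (by positivity)]
    have h1 : x ^ 4 ≤ x ^ 6 := pow_le_pow_right₀ hx1 (by norm_num)
    nlinarith [sq_nonneg m, pow_pos (by linarith : 0 < x) 4]
  have himage : φ '' Ioo a b ⊆ Ioc 0 (⌈b ^ 2⌉₊ : ℝ) := by
    rintro _ ⟨x, hx, rfl⟩
    refine ⟨sqrt_pos.2 (hpos x hx), le_trans ?_ (Nat.le_ceil _)⟩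
    rw [hφ, sqrt_le_left (by positivity)]
    have : x ^ 2 ≤ b ^ 2 := pow_le_pow_left₀ (by linarith [hx.1]) hx.2.le 2
    nlinarith [sq_nonneg m, sq_nonneg x]
  have hint : IntegrableOn g (Ioc 0 (⌈b ^ 2⌉₊ : ℝ)) :=
    (intervalIntegrable_iff_integrableOn_Ioc_of_le (by positivity)).1 (hgi _ _)
  have hint' := (integrableOn_image_iff_integrableOn_abs_deriv_smul measurableSet_Ioo hderiv hinj
    g).1 (hint.mono_set himage)
  calc ∫ x in a..b, g (φ x) = ∫ x in Ioo a b, g (φ x) := by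
        rw [intervalIntegral.integral_of_le hab, integral_Ioc_eq_integral_Ioo]
    _ ≤ ∫ x in Ioo a b, |φ' x| • g (φ x) := by
        refine integral_mono_of_nonneg (Filter.Eventually.of_forall fun x => hg0 _) hint' ?_
        refine (ae_restrict_mem measurableSet_Ioo).mono fun x hx => ?_
        exact le_mul_of_one_le_left (hg0 _) (hφ'1 x hx)
    _ = ∫ t in φ '' Ioo a b, g t :=
        (integral_image_eq_integral_abs_deriv_smul measurableSet_Ioo hderiv hinj g).symm
    _ ≤ ∫ t in Ioc 0 (⌈b ^ 2⌉₊ : ℝ), g t :=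
        setIntegral_mono_set hint (Filter.Eventually.of_forall hg0)
          (Filter.Eventually.of_forall himage)
    _ = ⌈b ^ 2⌉₊ * ∫ t in (0 : ℝ)..1, g t := by
        rw [← intervalIntegral.integral_of_le (by positivity)]
        have := hg.intervalIntegral_add_zsmul_eq ⌈b ^ 2⌉₊ 0 hgi
        simpa using this

/-- Two orthogonal vectors of `ℤ²` are multiples of a vector and of its quarter turn. -/
lemma exists_eq_smul_of_orthogonal (d₁ d₂ e₁ e₂ : ℤ) (h : d₁ * e₁ + d₂ * e₂ = 0) :
    ∃ s t g k : ℤ, (s, t) ≠ (0, 0) ∧ d₁ = g * s ∧ d₂ = g * t ∧ e₁ = -(k * t) ∧ e₂ = k * s := by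
  have hcop : ∀ a b : ℤ, (a, b) ≠ (0, 0) → ∃ s t g x y : ℤ, a = g * s ∧ b = g * t ∧ g ≠ 0 ∧
      s * x + t * y = 1 := by
    intro a b hab
    have hg : 0 < Int.gcd a b := by
      rw [Int.gcd_pos_iff]
      by_contra! hcon
      exact hab (by rw [hcon.1, hcon.2])
    obtain ⟨s, t, hst, ha, hb⟩ := Int.exists_gcd_one hg
    obtain ⟨x, y, hxy⟩ := Int.isCoprime_iff_gcd_eq_one.2 hst
    exact ⟨s, t, Int.gcd a b, x, y, by rw [mul_comm]; exact ha, by rw [mul_comm]; exact hb,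
      by exact_mod_cast hg.ne', by linarith⟩
  have hne : ∀ s t x y : ℤ, s * x + t * y = 1 → (s, t) ≠ (0, 0) := by
    rintro s t x y hxy heq
    obtain ⟨rfl, rfl⟩ := Prod.mk.inj heq
    simp at hxy
  by_cases hd : (d₁, d₂) = (0, 0)
  · obtain ⟨rfl, rfl⟩ := Prod.mk.inj hd
    by_cases he : (e₂, -e₁) = (0, 0)
    · obtain ⟨h2, h1⟩ := Prod.mk.inj he
      exact ⟨1, 0, 0, 0, by simp, by simp, by simp, by simpa using h1, by simpa using h2⟩
    · obtain ⟨s, t, g, x, y, hs, ht, -, hxy⟩ := hcop _ _ he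
      exact ⟨s, t, 0, g, hne _ _ _ _ hxy, by simp, by simp, by linarith, hs⟩
  · obtain ⟨s, t, g, x, y, rfl, rfl, hg, hxy⟩ := hcop _ _ hd
    have horth : s * e₁ + t * e₂ = 0 := by
      refine (mul_eq_zero.1 (?_ : g * (s * e₁ + t * e₂) = 0)).resolve_left hg
      linarith
    refine ⟨s, t, g, x * e₂ - y * e₁, hne _ _ _ _ hxy, rfl, rfl, ?_, ?_⟩
    · linear_combination x * horth - e₁ * hxy
    · linear_combination y * horth - e₂ * hxy

lemma sum_Icc_inv_le_one_add_log (n : ℕ) : ∑ i ∈ Finset.Icc 1 n, (i : ℝ)⁻¹ ≤ 1 + log n := by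
  have h := harmonic_le_one_add_log n
  rw [harmonic_eq_sum_Icc] at h
  push_cast at h
  exact h

lemma sum_Icc_int_natAbs_le {f : ℕ → ℝ} (hf : ∀ i, 0 ≤ f i) (L : ℕ) :
    ∑ s ∈ (Finset.Icc (-(L : ℤ)) L).erase 0, f s.natAbs ≤ 2 * ∑ i ∈ Finset.Icc 1 L, f i := by
  have hmaps : ∀ s ∈ (Finset.Icc (-(L : ℤ)) L).erase 0, s.natAbs ∈ Finset.Icc 1 L := by
    intro s hs
    simp only [Finset.mem_erase, Finset.mem_Icc] at hs ⊢
    omega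
  rw [← Finset.sum_fiberwise_of_maps_to hmaps, Finset.mul_sum]
  refine Finset.sum_le_sum fun i _ => ?_
  have hcard : ({s ∈ (Finset.Icc (-(L : ℤ)) L).erase 0 | s.natAbs = i}).card ≤ 2 := by
    refine (Finset.card_le_card (t := {(i : ℤ), -(i : ℤ)}) fun s hs => ?_).trans Finset.card_le_two
    have := (Finset.mem_filter.1 hs).2
    simp only [Finset.mem_insert, Finset.mem_singleton]
    omega
  rw [Finset.sum_congr rfl fun s hs => by rw [(Finset.mem_filter.1 hs).2], Finset.sum_const,
    nsmul_eq_mul]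
  exact mul_le_mul_of_nonneg_right (by exact_mod_cast hcard) (hf i)

lemma card_filter_natAbs_le (L i : ℕ) :
    ({s ∈ Finset.Icc (-(L : ℤ)) L | s.natAbs ≤ i}).card ≤ 2 * i + 1 := by
  refine (Finset.card_le_card (t := Finset.Icc (-(i : ℤ)) i) fun s hs => ?_).trans ?_
  · have := (Finset.mem_filter.1 hs).2
    rw [Finset.mem_Icc]
    omega
  · rw [Int.card_Icc]
    omega

/-- Lattice sum of the inverse square of the sup norm. -/
lemma sum_inv_sq_max_natAbs_le (L : ℕ) :
    ∑ p ∈ (Finset.Icc (-(L : ℤ)) L ×ˢ Finset.Icc (-(L : ℤ)) L).erase (0, 0),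
      (((max p.1.natAbs p.2.natAbs : ℕ) : ℝ) ^ 2)⁻¹ ≤ 12 * (1 + log L) := by
  set I := Finset.Icc (-(L : ℤ)) L with hI
  set w : ℤ → ℤ → ℝ := fun s t =>
    if t.natAbs ≤ s.natAbs then ((s.natAbs : ℝ) ^ 2)⁻¹ else 0 with hw
  have hw0 : ∀ s t, 0 ≤ w s t := fun s t => by
    simp only [hw]
    split_ifs <;> positivity
  have hpoint : ∀ p ∈ (I ×ˢ I).erase (0, 0),
      (((max p.1.natAbs p.2.natAbs : ℕ) : ℝ) ^ 2)⁻¹ ≤ w p.1 p.2 + w p.2 p.1 := by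
    intro p _
    rcases le_total p.2.natAbs p.1.natAbs with h | h
    · rw [max_eq_left h]
      refine le_add_of_le_of_nonneg ?_ (hw0 _ _)
      simp only [hw, if_pos h, le_refl]
    · rw [max_eq_right h]
      refine le_add_of_nonneg_of_le (hw0 _ _) ?_
      simp only [hw, if_pos h, le_refl]
  have hsum : ∑ s ∈ I, ∑ t ∈ I, w s t ≤ 6 * (1 + log L) := by
    have hinner : ∀ s ∈ I.erase 0, ∑ t ∈ I, w s t ≤ 3 * ((s.natAbs : ℕ) : ℝ)⁻¹ := by
      intro s hs
      have hs0 : 1 ≤ s.natAbs := by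
        have := (Finset.mem_erase.1 hs).1
        omega
      have hs1 : (1 : ℝ) ≤ s.natAbs := by exact_mod_cast hs0
      simp only [hw]
      rw [← Finset.sum_filter, Finset.sum_const, nsmul_eq_mul]
      have hcard : (({t ∈ I | t.natAbs ≤ s.natAbs}).card : ℝ) ≤ 3 * s.natAbs := by
        have : ({t ∈ I | t.natAbs ≤ s.natAbs}).card ≤ 3 * s.natAbs :=
          (card_filter_natAbs_le L _).trans (by omega)
        exact_mod_cast this
      calc _ ≤ 3 * (s.natAbs : ℝ) * ((s.natAbs : ℝ) ^ 2)⁻¹ := by gcongr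
        _ = 3 * ((s.natAbs : ℕ) : ℝ)⁻¹ := by field_simp
    have hzero : ∑ t ∈ I, w 0 t = 0 := by simp [hw]
    rw [← Finset.add_sum_erase I _ (show (0 : ℤ) ∈ I by simp [hI]), hzero, zero_add]
    calc _ ≤ ∑ s ∈ I.erase 0, 3 * ((s.natAbs : ℕ) : ℝ)⁻¹ := Finset.sum_le_sum hinner
      _ ≤ 2 * ∑ i ∈ Finset.Icc 1 L, 3 * (i : ℝ)⁻¹ :=
        sum_Icc_int_natAbs_le (f := fun i => 3 * (i : ℝ)⁻¹) (fun i => by positivity) L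
      _ ≤ 6 * (1 + log L) := by
        rw [← Finset.mul_sum]
        linarith [sum_Icc_inv_le_one_add_log L]
  calc _ ≤ ∑ p ∈ (I ×ˢ I).erase (0, 0), (w p.1 p.2 + w p.2 p.1) := Finset.sum_le_sum hpoint
    _ ≤ ∑ p ∈ I ×ˢ I, (w p.1 p.2 + w p.2 p.1) :=
      Finset.sum_le_sum_of_subset_of_nonneg (Finset.erase_subset _ _)
        fun p _ _ => add_nonneg (hw0 _ _) (hw0 _ _)
    _ = ∑ s ∈ I, ∑ t ∈ I, w s t + ∑ s ∈ I, ∑ t ∈ I, w s t := by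
      rw [Finset.sum_add_distrib, Finset.sum_product, Finset.sum_product_right]
    _ ≤ 12 * (1 + log L) := by linarith

/-- Pairs of points of a box of `ℤ²` on a common circle about the origin. -/
lemma card_equal_norm_pairs_le (K L : ℕ) (hL : 0 < L) (hKL : 2 * K ≤ L) :
    ((((Finset.Icc (-(K : ℤ)) K ×ˢ Finset.Icc (-(K : ℤ)) K) ×ˢ
      (Finset.Icc (-(K : ℤ)) K ×ˢ Finset.Icc (-(K : ℤ)) K)).filter fun q =>
        q.1.1 ^ 2 + q.1.2 ^ 2 = q.2.1 ^ 2 + q.2.2 ^ 2).card : ℝ) ≤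
      108 * (L : ℝ) ^ 2 * (1 + log L) := by
  set W := ((Finset.Icc (-(K : ℤ)) K ×ˢ Finset.Icc (-(K : ℤ)) K) ×ˢ
      (Finset.Icc (-(K : ℤ)) K ×ˢ Finset.Icc (-(K : ℤ)) K)).filter fun q =>
        q.1.1 ^ 2 + q.1.2 ^ 2 = q.2.1 ^ 2 + q.2.2 ^ 2 with hW
  set I := Finset.Icc (-(L : ℤ)) L with hI
  set J : ℤ × ℤ → Finset ℤ := fun p =>
    I.filter fun g => g.natAbs ≤ L / max p.1.natAbs p.2.natAbs with hJ
  set P := ((I ×ˢ I).erase (0, 0)).sigma fun p => J p ×ˢ J p with hP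
  -- `p - q` and `p + q` are orthogonal, hence parametrised by `P`
  have hparam : ∀ q ∈ W, ∃ z ∈ P, q.1.1 - q.2.1 = z.2.1 * z.1.1 ∧ q.1.2 - q.2.2 = z.2.1 * z.1.2 ∧
      q.1.1 + q.2.1 = -(z.2.2 * z.1.2) ∧ q.1.2 + q.2.2 = z.2.2 * z.1.1 := by
    rintro ⟨⟨a, b⟩, ⟨c, d⟩⟩ hq
    simp only [hW, Finset.mem_filter, Finset.mem_product, Finset.mem_Icc] at hq
    obtain ⟨⟨⟨⟨ha1, ha2⟩, hb1, hb2⟩, ⟨hc1, hc2⟩, hd1, hd2⟩, heq⟩ := hq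
    obtain ⟨s, t, g, k, hst, h1, h2, h3, h4⟩ :=
      exists_eq_smul_of_orthogonal (a - c) (b - d) (a + c) (b + d) (by linarith)
    by_cases hgk : g = 0 ∧ k = 0
    · obtain ⟨rfl, rfl⟩ := hgk
      refine ⟨⟨(1, 0), (0, 0)⟩, ?_, by simp_all, by simp_all, by simp_all, by simp_all⟩
      simp only [hP, hJ, hI, Finset.mem_sigma, Finset.mem_erase, Finset.mem_product,
        Finset.mem_filter, Finset.mem_Icc]
      exact ⟨⟨by simp, by simp; omega⟩, by simp⟩
    · have hmax : 0 < max s.natAbs t.natAbs := by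
        rw [lt_max_iff, Int.natAbs_pos, Int.natAbs_pos]
        by_contra! hcon
        exact hst (by rw [hcon.1, hcon.2])
      have hgs : g.natAbs * s.natAbs ≤ L := by rw [← Int.natAbs_mul]; omega
      have hgt : g.natAbs * t.natAbs ≤ L := by rw [← Int.natAbs_mul]; omega
      have hks : k.natAbs * s.natAbs ≤ L := by rw [← Int.natAbs_mul]; omega
      have hkt : k.natAbs * t.natAbs ≤ L := by rw [← Int.natAbs_mul]; omega
      have hg : g.natAbs ≤ L / max s.natAbs t.natAbs := by
        rw [Nat.le_div_iff_mul_le hmax, ← Nat.mul_max_mul_left]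
        exact max_le hgs hgt
      have hk : k.natAbs ≤ L / max s.natAbs t.natAbs := by
        rw [Nat.le_div_iff_mul_le hmax, ← Nat.mul_max_mul_left]
        exact max_le hks hkt
      have hstL : s.natAbs ≤ L ∧ t.natAbs ≤ L := by
        rcases not_and_or.1 hgk with h0 | h0
        · have : 0 < g.natAbs := Int.natAbs_pos.2 h0
          exact ⟨by nlinarith, by nlinarith⟩
        · have : 0 < k.natAbs := Int.natAbs_pos.2 h0
          exact ⟨by nlinarith, by nlinarith⟩
      have hdivL := Nat.div_le_self L (max s.natAbs t.natAbs)
      refine ⟨⟨(s, t), (g, k)⟩, ?_, h1, h2, h3, h4⟩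
      simp only [hP, hJ, hI, Finset.mem_sigma, Finset.mem_erase, Finset.mem_product,
        Finset.mem_filter, Finset.mem_Icc]
      exact ⟨⟨hst, by omega, by omega⟩, ⟨by omega, hg⟩, by omega, hk⟩
  have hcard : W.card ≤ P.card := by
    choose! z hz using hparam
    refine Finset.card_le_card_of_injOn z (fun q hq => (hz q hq).1) fun q hq q' hq' heq => ?_
    obtain ⟨-, h1, h2, h3, h4⟩ := hz q hq
    obtain ⟨-, h1', h2', h3', h4'⟩ := hz q' hq'
    rw [← heq] at h1' h2' h3' h4'
    ext <;> omega
  have hJcard : ∀ p ∈ (I ×ˢ I).erase (0, 0), ((J p ×ˢ J p).card : ℝ) ≤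
      9 * (L : ℝ) ^ 2 * (((max p.1.natAbs p.2.natAbs : ℕ) : ℝ) ^ 2)⁻¹ := by
    intro p hp
    set i := max p.1.natAbs p.2.natAbs with hi
    simp only [hI, Finset.mem_erase, Finset.mem_product, Finset.mem_Icc, ne_eq,
      Prod.ext_iff] at hp
    have hi0 : 0 < i := by omega
    have hiL : i ≤ L := by omega
    have h1 : 1 ≤ L / i := Nat.div_pos hiL hi0
    have h2 : (J p).card ≤ 2 * (L / i) + 1 := card_filter_natAbs_le L _
    have h3 : ((J p).card : ℝ) ≤ 3 * (L / i) :=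
      calc ((J p).card : ℝ) ≤ ((3 * (L / i) : ℕ) : ℝ) := by
            exact_mod_cast h2.trans (by omega)
        _ ≤ 3 * (L / i) := by
          push_cast
          gcongr
          exact Nat.cast_div_le
    rw [Finset.card_product]
    push_cast
    calc ((J p).card : ℝ) * (J p).card ≤ (3 * (L / i)) * (3 * (L / i)) := by gcongr
      _ = _ := by field_simp; ring
  calc (W.card : ℝ) ≤ P.card := by exact_mod_cast hcard
    _ = ∑ p ∈ (I ×ˢ I).erase (0, 0), ((J p ×ˢ J p).card : ℝ) := by
      rw [hP, Finset.card_sigma]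
      push_cast
      rfl
    _ ≤ ∑ p ∈ (I ×ˢ I).erase (0, 0),
        9 * (L : ℝ) ^ 2 * (((max p.1.natAbs p.2.natAbs : ℕ) : ℝ) ^ 2)⁻¹ :=
      Finset.sum_le_sum hJcard
    _ ≤ 108 * (L : ℝ) ^ 2 * (1 + log L) := by
      rw [← Finset.mul_sum]
      have := mul_le_mul_of_nonneg_left (sum_inv_sq_max_natAbs_le L)
        (by positivity : 0 ≤ 9 * (L : ℝ) ^ 2)
      linarith

lemma r2_eq_card_filter {m K : ℕ} (hK : Nat.sqrt m ≤ K) :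
    r2 m = ((Finset.Icc (-(K : ℤ)) K ×ˢ Finset.Icc (-(K : ℤ)) K).filter fun p =>
      p.1 ^ 2 + p.2 ^ 2 = (m : ℤ)).card := by
  refine Nat.subtype_card _ fun p => ?_
  simp only [Finset.mem_filter, Finset.mem_product, Finset.mem_Icc, and_iff_right_iff_imp]
  intro hp
  have hbound : ∀ a : ℤ, a ^ 2 ≤ m → a.natAbs ≤ K := by
    intro a ha
    refine (Nat.le_sqrt'.2 ?_).trans hK
    zify
    rwa [sq_abs]
  have h1 := hbound p.1 (by nlinarith [sq_nonneg p.2])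
  have h2 := hbound p.2 (by nlinarith [sq_nonneg p.1])
  omega

/-- The second moment of `r2`. -/
lemma sum_r2_sq_le (M : ℕ) :
    ∑ m ∈ Finset.range (M + 1), (r2 m : ℝ) ^ 2 ≤ 2916 * (M + 1) * (1 + log (M + 1)) := by
  set K := Nat.sqrt M with hK
  set box := Finset.Icc (-(K : ℤ)) K ×ˢ Finset.Icc (-(K : ℤ)) K with hbox
  set W := (box ×ˢ box).filter fun q =>
    q.1.1 ^ 2 + q.1.2 ^ 2 = q.2.1 ^ 2 + q.2.2 ^ 2 with hW
  have hsum : ∑ m ∈ Finset.range (M + 1), r2 m ^ 2 ≤ W.card := by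
    calc ∑ m ∈ Finset.range (M + 1), r2 m ^ 2
        = ∑ m ∈ Finset.range (M + 1),
          (W.filter fun q => (q.1.1 ^ 2 + q.1.2 ^ 2).toNat = m).card := by
          refine Finset.sum_congr rfl fun m hm => ?_
          have hmK : Nat.sqrt m ≤ K := Nat.sqrt_le_sqrt (by have := Finset.mem_range.1 hm; omega)
          rw [sq, r2_eq_card_filter hmK, ← Finset.card_product]
          congr 1
          ext q
          have h0 : 0 ≤ q.1.1 ^ 2 + q.1.2 ^ 2 := by positivity
          simp only [hW, hbox, Finset.mem_product, Finset.mem_filter]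
          constructor
          · rintro ⟨⟨h1, h2⟩, h3, h4⟩
            exact ⟨⟨⟨h1, h3⟩, by omega⟩, by omega⟩
          · rintro ⟨⟨⟨h1, h3⟩, h4⟩, h5⟩
            exact ⟨⟨h1, by omega⟩, h3, by omega⟩
      _ ≤ W.card := by
          rw [Finset.sum_card_fiberwise_eq_card_filter]
          exact Finset.card_filter_le _ _
  have hcount := card_equal_norm_pairs_le K (2 * K + 1) (by omega) (by omega)
  have hKM : K * K ≤ M := Nat.sqrt_le M
  have hKM' : K ≤ M := Nat.sqrt_le_self M
  have hL2 : (((2 * K + 1 : ℕ) : ℝ)) ^ 2 ≤ 9 * (M + 1) := by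
    have : (2 * K + 1) ^ 2 ≤ 9 * (M + 1) := by nlinarith
    exact_mod_cast this
  have hlog : log ((2 * K + 1 : ℕ) : ℝ) ≤ 2 + log (M + 1) := by
    have h3 : log 3 ≤ 2 := by linarith [log_le_sub_one_of_pos (by norm_num : (0 : ℝ) < 3)]
    have hle : ((2 * K + 1 : ℕ) : ℝ) ≤ 3 * (M + 1) := by
      have : 2 * K + 1 ≤ 3 * (M + 1) := by omega
      exact_mod_cast this
    have := log_le_log (by positivity) hle
    rw [log_mul (by norm_num) (by positivity)] at this
    linarith
  have hlog0 : 0 ≤ log ((M : ℝ) + 1) := log_nonneg (by linarith [Nat.cast_nonneg (α := ℝ) M])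
  calc ∑ m ∈ Finset.range (M + 1), (r2 m : ℝ) ^ 2 ≤ W.card := by exact_mod_cast hsum
    _ ≤ 108 * ((2 * K + 1 : ℕ) : ℝ) ^ 2 * (1 + log ((2 * K + 1 : ℕ) : ℝ)) := hcount
    _ ≤ 108 * (9 * (M + 1)) * (3 * (1 + log (M + 1))) := by
      gcongr
      linarith
    _ = 2916 * (M + 1) * (1 + log (M + 1)) := by ring

lemma sum_div_succ_le {a : ℕ → ℝ} {C : ℝ} {N : ℕ}
    (h : ∀ n ≤ N, ∑ m ∈ Finset.range (n + 1), a m ≤ C * (n + 1)) (hC : 0 ≤ C) :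
    ∑ m ∈ Finset.range (N + 1), a m / (m + 1) ≤ C * (2 + log (N + 1)) := by
  have habel : ∀ n, ∑ m ∈ Finset.range (n + 1), a m / ((m : ℝ) + 1) =
      (∑ m ∈ Finset.range (n + 1), a m) / (n + 2) +
      ∑ k ∈ Finset.range (n + 1), (∑ m ∈ Finset.range (k + 1), a m) / (((k : ℝ) + 1) * (k + 2)) := by
    intro n
    induction n with
    | zero => simp
    | succ n ih =>
      rw [Finset.sum_range_succ, ih, Finset.sum_range_succ (fun k : ℕ =>
        (∑ m ∈ Finset.range (k + 1), a m) / (((k : ℝ) + 1) * (k + 2))) (n + 1),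
        Finset.sum_range_succ a (n + 1)]
      push_cast
      field_simp
      ring
  have hharm : ∑ k ∈ Finset.range (N + 1), ((k : ℝ) + 1)⁻¹ ≤ 1 + log (N + 1) := by
    have := harmonic_le_one_add_log (N + 1)
    simpa [harmonic] using this
  rw [habel]
  have h1 : (∑ m ∈ Finset.range (N + 1), a m) / ((N : ℝ) + 2) ≤ C := by
    rw [div_le_iff₀ (by positivity)]
    linarith [h N le_rfl]
  have h2 : ∑ k ∈ Finset.range (N + 1),
      (∑ m ∈ Finset.range (k + 1), a m) / (((k : ℝ) + 1) * (k + 2)) ≤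
      ∑ k ∈ Finset.range (N + 1), C * ((k : ℝ) + 1)⁻¹ := by
    refine Finset.sum_le_sum fun k hk => ?_
    have hk' := h k (by have := Finset.mem_range.1 hk; omega)
    rw [div_le_iff₀ (by positivity)]
    have : C * ((k : ℝ) + 1)⁻¹ * ((k + 1) * (k + 2)) = C * (k + 2) := by field_simp
    rw [this]
    linarith
  rw [← Finset.mul_sum] at h2
  nlinarith

lemma sum_r2_sq_div_succ_le (N : ℕ) :
    ∑ m ∈ Finset.range (N + 1), (r2 m : ℝ) ^ 2 / (m + 1) ≤
      5832 * (1 + log (N + 1)) ^ 2 := by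
  have hlog0 : 0 ≤ log ((N : ℝ) + 1) := log_nonneg (by linarith [Nat.cast_nonneg (α := ℝ) N])
  refine (sum_div_succ_le (C := 2916 * (1 + log (N + 1))) (fun n hn => ?_) (by positivity)).trans ?_
  · refine (sum_r2_sq_le n).trans ?_
    have : log ((n : ℝ) + 1) ≤ log (N + 1) := by gcongr
    nlinarith [Nat.cast_nonneg (α := ℝ) n]
  · nlinarith

lemma sum_inv_abs_sub_le {N n : ℕ} (hn : n ≤ N) :
    ∑ m ∈ (Finset.range (N + 1)).erase n, |(m : ℝ) - n|⁻¹ ≤ 2 * (1 + log (N + 1)) := by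
  have hmaps : ∀ m ∈ (Finset.range (N + 1)).erase n,
      ((m : ℤ) - n) ∈ (Finset.Icc (-(N : ℤ)) N).erase 0 := by
    intro m hm
    simp only [Finset.mem_erase, Finset.mem_range, Finset.mem_Icc] at hm ⊢
    omega
  have hinj : InjOn (fun m : ℕ => (m : ℤ) - n) ((Finset.range (N + 1)).erase n) := by
    intro m _ m' _ h
    simp only at h
    omega
  calc ∑ m ∈ (Finset.range (N + 1)).erase n, |(m : ℝ) - n|⁻¹
      = ∑ s ∈ ((Finset.range (N + 1)).erase n).image fun m : ℕ => (m : ℤ) - n,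
        ((s.natAbs : ℕ) : ℝ)⁻¹ := by
        rw [Finset.sum_image hinj]
        refine Finset.sum_congr rfl fun m _ => ?_
        rw [Nat.cast_natAbs]
        push_cast
        rfl
    _ ≤ ∑ s ∈ (Finset.Icc (-(N : ℤ)) N).erase 0, ((s.natAbs : ℕ) : ℝ)⁻¹ :=
        Finset.sum_le_sum_of_subset_of_nonneg (Finset.image_subset_iff.2 hmaps)
          fun s _ _ => by positivity
    _ ≤ 2 * ∑ i ∈ Finset.Icc 1 N, (i : ℝ)⁻¹ :=
        sum_Icc_int_natAbs_le (f := fun i => (i : ℝ)⁻¹) (fun i => by positivity) N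
    _ ≤ 2 * (1 + log (N + 1)) := by
        have h1 := sum_Icc_inv_le_one_add_log N
        have h2 : log (N : ℝ) ≤ log (N + 1) := by
          rcases Nat.eq_zero_or_pos N with rfl | hN
          · simp
          · exact log_le_log (by exact_mod_cast hN) (by linarith)
        linarith

/-- The off-diagonal sum. -/
lemma sum_r2_mul_r2_div_abs_sq_sub_sq_le (N : ℕ) :
    ∑ m ∈ Finset.range (N + 1), ∑ n ∈ (Finset.range (N + 1)).erase m,
      (r2 m : ℝ) * r2 n / |(m : ℝ) ^ 2 - (n : ℝ) ^ 2| ≤ 23328 * (1 + log (N + 1)) ^ 3 := by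
  have hpoint : ∀ m n : ℕ, m ≠ n → (r2 m : ℝ) * r2 n / |(m : ℝ) ^ 2 - (n : ℝ) ^ 2| ≤
      (r2 m : ℝ) ^ 2 / (m + 1) * |(n : ℝ) - m|⁻¹ + (r2 n : ℝ) ^ 2 / (n + 1) * |(m : ℝ) - n|⁻¹ := by
    intro m n hmn
    have hpos : 0 < |(m : ℝ) - n| := by
      rw [abs_pos, sub_ne_zero]
      exact_mod_cast hmn
    have hsum : 1 ≤ m + n := by omega
    have hsum' : (1 : ℝ) ≤ m + n := by exact_mod_cast hsum
    have hm0 : (0 : ℝ) ≤ m := Nat.cast_nonneg m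
    have hn0 : (0 : ℝ) ≤ n := Nat.cast_nonneg n
    have hfac : |(m : ℝ) ^ 2 - (n : ℝ) ^ 2| = (m + n) * |(m : ℝ) - n| := by
      rw [sq_sub_sq, abs_mul, abs_of_nonneg (by linarith)]
    rw [hfac, abs_sub_comm (n : ℝ) m, ← add_mul, div_mul_eq_div_div, div_eq_mul_inv _ |_|]
    refine mul_le_mul_of_nonneg_right ?_ (by positivity)
    have h1 : (r2 m : ℝ) ^ 2 / (2 * (m + n)) ≤ (r2 m : ℝ) ^ 2 / (m + 1) := by
      gcongr
      linarith
    have h2 : (r2 n : ℝ) ^ 2 / (2 * (m + n)) ≤ (r2 n : ℝ) ^ 2 / (n + 1) := by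
      gcongr
      linarith
    refine le_trans ?_ (add_le_add h1 h2)
    rw [← add_div, div_le_div_iff₀ (by linarith) (by linarith)]
    have := two_mul_le_add_sq (r2 m : ℝ) (r2 n)
    nlinarith
  have hhalf : ∑ m ∈ Finset.range (N + 1), ∑ n ∈ (Finset.range (N + 1)).erase m,
      (r2 m : ℝ) ^ 2 / (m + 1) * |(n : ℝ) - m|⁻¹ ≤ 11664 * (1 + log (N + 1)) ^ 3 := by
    have hlog0 : 0 ≤ log ((N : ℝ) + 1) := log_nonneg (by linarith [Nat.cast_nonneg (α := ℝ) N])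
    calc _ ≤ ∑ m ∈ Finset.range (N + 1), (r2 m : ℝ) ^ 2 / (m + 1) * (2 * (1 + log (N + 1))) := by
          refine Finset.sum_le_sum fun m hm => ?_
          rw [← Finset.mul_sum]
          gcongr
          exact sum_inv_abs_sub_le (by have := Finset.mem_range.1 hm; omega)
      _ ≤ 5832 * (1 + log (N + 1)) ^ 2 * (2 * (1 + log (N + 1))) := by
          rw [← Finset.sum_mul]
          gcongr
          exact sum_r2_sq_div_succ_le N
      _ = _ := by ring
  have hswap : ∑ m ∈ Finset.range (N + 1), ∑ n ∈ (Finset.range (N + 1)).erase m,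
      (r2 n : ℝ) ^ 2 / (n + 1) * |(m : ℝ) - n|⁻¹ =
      ∑ m ∈ Finset.range (N + 1), ∑ n ∈ (Finset.range (N + 1)).erase m,
      (r2 m : ℝ) ^ 2 / (m + 1) * |(n : ℝ) - m|⁻¹ := by
    refine Finset.sum_comm' fun m n => ?_
    simp only [Finset.mem_erase]
    tauto
  calc _ ≤ ∑ m ∈ Finset.range (N + 1), ∑ n ∈ (Finset.range (N + 1)).erase m,
        ((r2 m : ℝ) ^ 2 / (m + 1) * |(n : ℝ) - m|⁻¹ +
          (r2 n : ℝ) ^ 2 / (n + 1) * |(m : ℝ) - n|⁻¹) :=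
        Finset.sum_le_sum fun m _ => Finset.sum_le_sum fun n hn =>
          hpoint m n (Finset.ne_of_mem_erase hn).symm
    _ ≤ _ := by
        simp_rw [Finset.sum_add_distrib]
        rw [hswap]
        linarith

lemma intervalIntegrable_of_measurable_of_abs_le {f : ℝ → ℝ} (hf : Measurable f) {B : ℝ}
    (hB : ∀ x, |f x| ≤ B) (u v : ℝ) : IntervalIntegrable f volume u v :=
  (intervalIntegrable_const (c := B)).mono_fun hf.aestronglyMeasurable
    (Filter.Eventually.of_forall fun x => by
      simpa only [norm_eq_abs] using (hB x).trans (le_abs_self B))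

/-- The indicator of `m ≤ x²`. -/
noncomputable def cutoff (m : ℕ) (x : ℝ) : ℝ := if (m : ℝ) ≤ x ^ 2 then 1 else 0

lemma cutoff_nonneg (m : ℕ) (x : ℝ) : 0 ≤ cutoff m x := by
  unfold cutoff
  split_ifs <;> norm_num

lemma cutoff_le_one (m : ℕ) (x : ℝ) : cutoff m x ≤ 1 := by
  unfold cutoff
  split_ifs <;> norm_num

lemma cutoff_sq (m : ℕ) (x : ℝ) : cutoff m x ^ 2 = cutoff m x := by
  unfold cutoff
  split_ifs <;> norm_num

lemma cutoff_mul_cutoff {m n : ℕ} (h : n ≤ m) (x : ℝ) :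
    cutoff m x * cutoff n x = cutoff m x := by
  have : (n : ℝ) ≤ m := by exact_mod_cast h
  unfold cutoff
  split_ifs <;> linarith

lemma measurable_cutoff (m : ℕ) : Measurable (cutoff m) :=
  Measurable.ite (measurableSet_le measurable_const (by fun_prop)) measurable_const
    measurable_const

lemma integral_cutoff_mul {X : ℝ} (hX : 0 < X) {m : ℕ} (hm : (m : ℝ) ≤ (2 * X) ^ 2)
    (f : ℝ → ℝ) :
    ∫ x in X..2 * X, cutoff m x * f x = ∫ x in (max X √m)..(2 * X), f x := by
  have hle : max X √m ≤ 2 * X := max_le (by linarith) ((sqrt_le_left (by linarith)).2 hm)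
  have hset : Icc X (2 * X) ∩ {x : ℝ | (m : ℝ) ≤ x ^ 2} = Icc (max X √m) (2 * X) := by
    ext x
    simp only [mem_inter_iff, mem_Icc, mem_ofPred_eq, max_le_iff]
    constructor
    · rintro ⟨⟨h1, h2⟩, h3⟩
      exact ⟨⟨h1, (sqrt_le_left (by linarith)).2 h3⟩, h2⟩
    · rintro ⟨⟨h1, h2⟩, h3⟩
      exact ⟨⟨h1, h3⟩, (sqrt_le_left (by linarith)).1 h2⟩
  have hmeas : MeasurableSet {x : ℝ | (m : ℝ) ≤ x ^ 2} :=
    measurableSet_le measurable_const (by fun_prop)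
  rw [intervalIntegral.integral_of_le (by linarith), intervalIntegral.integral_of_le hle,
    ← integral_Icc_eq_integral_Ioc, ← integral_Icc_eq_integral_Ioc, ← hset,
    ← setIntegral_indicator hmeas]
  refine integral_congr_ae (Filter.Eventually.of_forall fun x => ?_)
  by_cases hx : (m : ℝ) ≤ x ^ 2 <;> simp [cutoff, hx]

/-- The squared modulus of `∑ m ≤ N, r2 m * cutoff m x * exp (2 π i h √(x⁴ - m²))`. -/
noncomputable def normSqExpSum (h N : ℕ) (x : ℝ) : ℝ :=
  ∑ m ∈ Finset.range (N + 1), ∑ n ∈ Finset.range (N + 1), (r2 m : ℝ) * r2 n *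
    (cutoff m x * cutoff n x *
      cos (2 * π * h * (√((x ^ 2) ^ 2 - (m : ℝ) ^ 2) - √((x ^ 2) ^ 2 - (n : ℝ) ^ 2))))

lemma sq_sum_sin_le_normSqExpSum (h N : ℕ) (x : ℝ) :
    (∑ m ∈ Finset.range (N + 1), (r2 m : ℝ) * cutoff m x *
      sin (2 * π * h * √((x ^ 2) ^ 2 - (m : ℝ) ^ 2))) ^ 2 ≤ normSqExpSum h N x := by
  have heq : normSqExpSum h N x =
      (∑ m ∈ Finset.range (N + 1), (r2 m : ℝ) * cutoff m x *
        sin (2 * π * h * √((x ^ 2) ^ 2 - (m : ℝ) ^ 2))) ^ 2 +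
      (∑ m ∈ Finset.range (N + 1), (r2 m : ℝ) * cutoff m x *
        cos (2 * π * h * √((x ^ 2) ^ 2 - (m : ℝ) ^ 2))) ^ 2 := by
    rw [normSqExpSum, sq (∑ m ∈ _, _ * sin _), sq (∑ m ∈ _, _ * cos _), Finset.sum_mul_sum,
      Finset.sum_mul_sum, ← Finset.sum_add_distrib]
    refine Finset.sum_congr rfl fun m _ => ?_
    rw [← Finset.sum_add_distrib]
    refine Finset.sum_congr rfl fun n _ => ?_
    rw [mul_sub, cos_sub]
    ring
  rw [heq]
  exact le_add_of_nonneg_right (sq_nonneg _)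

lemma intervalIntegrable_cutoff_mul_cutoff_mul_cos (h m n : ℕ) (u v : ℝ) :
    IntervalIntegrable (fun x => cutoff m x * cutoff n x *
      cos (2 * π * h * (√((x ^ 2) ^ 2 - (m : ℝ) ^ 2) - √((x ^ 2) ^ 2 - (n : ℝ) ^ 2))))
      volume u v := by
  refine intervalIntegrable_of_measurable_of_abs_le (B := 1) ?_ (fun x => ?_) u v
  · exact ((measurable_cutoff m).mul (measurable_cutoff n)).mul
      (Continuous.measurable (by fun_prop))
  · rw [abs_mul, abs_mul, abs_of_nonneg (cutoff_nonneg m x), abs_of_nonneg (cutoff_nonneg n x)]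
    exact mul_le_one₀ (mul_le_one₀ (cutoff_le_one m x) (cutoff_nonneg n x) (cutoff_le_one n x))
      (abs_nonneg _) (abs_cos_le_one _)

lemma intervalIntegrable_normSqExpSum (h N : ℕ) (u v : ℝ) :
    IntervalIntegrable (normSqExpSum h N) volume u v := by
  have heq : normSqExpSum h N = ∑ m ∈ Finset.range (N + 1), ∑ n ∈ Finset.range (N + 1),
      fun x => (r2 m : ℝ) * r2 n * (cutoff m x * cutoff n x *
        cos (2 * π * h * (√((x ^ 2) ^ 2 - (m : ℝ) ^ 2) - √((x ^ 2) ^ 2 - (n : ℝ) ^ 2)))) := by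
    ext x
    simp only [normSqExpSum, Finset.sum_apply]
  rw [heq]
  exact IntervalIntegrable.sum _ fun m _ => IntervalIntegrable.sum _ fun n _ =>
    (intervalIntegrable_cutoff_mul_cutoff_mul_cos h m n u v).const_mul ((r2 m : ℝ) * r2 n)

lemma integral_offDiagonal_le {X : ℝ} (hX : 0 < X) {h m n : ℕ} (hh : h ≠ 0) (hmn : m ≠ n)
    (hm : (m : ℝ) ≤ (2 * X) ^ 2) (hn : (n : ℝ) ≤ (2 * X) ^ 2) :
    ∫ x in X..2 * X, cutoff m x * cutoff n x *
      cos (2 * π * h * (√((x ^ 2) ^ 2 - (m : ℝ) ^ 2) - √((x ^ 2) ^ 2 - (n : ℝ) ^ 2))) ≤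
      16 * X ^ 3 / (h * |(m : ℝ) ^ 2 - (n : ℝ) ^ 2|) := by
  have hlt : ∀ m n : ℕ, n < m → (m : ℝ) ≤ (2 * X) ^ 2 →
      ∫ x in X..2 * X, cutoff m x * cutoff n x *
        cos (2 * π * h * (√((x ^ 2) ^ 2 - (m : ℝ) ^ 2) - √((x ^ 2) ^ 2 - (n : ℝ) ^ 2))) ≤
        16 * X ^ 3 / (h * |(m : ℝ) ^ 2 - (n : ℝ) ^ 2|) := by
    intro m n hnm hm
    have hnm' : (n : ℝ) < m := by exact_mod_cast hnm
    have hn0 : (0 : ℝ) ≤ n := Nat.cast_nonneg n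
    have hdiff : 0 < (m : ℝ) ^ 2 - (n : ℝ) ^ 2 := by nlinarith
    have hh0 : (0 : ℝ) < h := by positivity
    simp_rw [cutoff_mul_cutoff hnm.le]
    rw [integral_cutoff_mul hX hm]
    have hma : (m : ℝ) ≤ (max X √m) ^ 2 := by
      calc (m : ℝ) = √m ^ 2 := (sq_sqrt (Nat.cast_nonneg m)).symm
        _ ≤ _ := by gcongr; exact le_max_right _ _
    have key := abs_integral_cos_sqrt_sub_sqrt_le (a := max X √m) (b := 2 * X) (c := 2 * π * h)
      (lt_max_of_lt_left hX) (max_le (by linarith) ((sqrt_le_left (by linarith)).2 hm))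
      (by positivity) hn0 hnm' hma
    refine (le_abs_self _).trans (key.trans ?_)
    rw [abs_of_pos hdiff, show 2 * ((2 * X) ^ 3 / (2 * π * h * ((m : ℝ) ^ 2 - (n : ℝ) ^ 2))) =
      16 * X ^ 3 / (2 * π * (h * ((m : ℝ) ^ 2 - (n : ℝ) ^ 2))) by field_simp; ring]
    exact div_le_div_of_nonneg_left (by positivity) (by positivity)
      (le_mul_of_one_le_left (by positivity) (by linarith [pi_gt_three]))
  rcases lt_or_gt_of_ne hmn with hlt' | hlt'
  · rw [abs_sub_comm]
    convert hlt n m hlt' hn using 2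
    ext x
    rw [mul_comm (cutoff m x), ← cos_neg]
    congr 2
    ring
  · exact hlt m n hlt' hm

lemma integral_normSqExpSum_le {X : ℝ} (hX : 0 < X) {h N : ℕ} (hh : h ≠ 0)
    (hN : (N : ℝ) ≤ (2 * X) ^ 2) :
    ∫ x in X..2 * X, normSqExpSum h N x ≤
      X * ∑ m ∈ Finset.range (N + 1), (r2 m : ℝ) ^ 2 +
      16 * X ^ 3 / h * ∑ m ∈ Finset.range (N + 1), ∑ n ∈ (Finset.range (N + 1)).erase m,
        (r2 m : ℝ) * r2 n / |(m : ℝ) ^ 2 - (n : ℝ) ^ 2| := by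
  have hint : ∀ m n : ℕ, IntervalIntegrable (fun x => (r2 m : ℝ) * r2 n *
      (cutoff m x * cutoff n x *
        cos (2 * π * h * (√((x ^ 2) ^ 2 - (m : ℝ) ^ 2) - √((x ^ 2) ^ 2 - (n : ℝ) ^ 2)))))
      volume X (2 * X) := fun m n =>
    (intervalIntegrable_cutoff_mul_cutoff_mul_cos h m n X (2 * X)).const_mul _
  have hmN : ∀ m ∈ Finset.range (N + 1), (m : ℝ) ≤ (2 * X) ^ 2 := fun m hm =>
    le_trans (by exact_mod_cast Nat.lt_succ_iff.1 (Finset.mem_range.1 hm)) hN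
  unfold normSqExpSum
  rw [intervalIntegral.integral_finsetSum fun m _ => by
    simpa only [Finset.sum_fn] using IntervalIntegrable.sum _ fun n _ => hint m n]
  rw [Finset.mul_sum, Finset.mul_sum, ← Finset.sum_add_distrib]
  refine Finset.sum_le_sum fun m hm => ?_
  rw [intervalIntegral.integral_finsetSum fun n _ => hint m n]
  simp_rw [intervalIntegral.integral_const_mul]
  rw [← Finset.add_sum_erase _ _ hm, Finset.mul_sum]
  refine add_le_add ?_ (Finset.sum_le_sum fun n hn => ?_)
  · have hdiag : ∫ x in X..2 * X, cutoff m x * cutoff m x *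
        cos (2 * π * h * (√((x ^ 2) ^ 2 - (m : ℝ) ^ 2) - √((x ^ 2) ^ 2 - (m : ℝ) ^ 2))) ≤ X := by
      calc _ ≤ ∫ _ in X..2 * X, (1 : ℝ) := by
            refine intervalIntegral.integral_mono_on (by linarith)
              (intervalIntegrable_cutoff_mul_cutoff_mul_cos h m m X (2 * X))
              intervalIntegrable_const fun x _ => ?_
            rw [sub_self, mul_zero, cos_zero, mul_one]
            exact mul_le_one₀ (cutoff_le_one m x) (cutoff_nonneg m x) (cutoff_le_one m x)
        _ = X := by simp; ring
    nlinarith [sq_nonneg (r2 m : ℝ)]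
  · have hoff := integral_offDiagonal_le hX hh (Finset.ne_of_mem_erase hn).symm (hmN m hm)
      (hmN n (Finset.mem_of_mem_erase hn))
    calc _ ≤ (r2 m : ℝ) * r2 n * (16 * X ^ 3 / (h * |(m : ℝ) ^ 2 - (n : ℝ) ^ 2|)) := by gcongr
      _ = _ := by rw [div_mul_div_comm, mul_div_assoc']; ring

lemma integral_cutoff_mul_sawtoothTail_sq_le {X : ℝ} (hX : 1 ≤ X) {H m : ℕ} (hH : H ≠ 0)
    (hm : (m : ℝ) ≤ (2 * X) ^ 2) :
    ∫ x in X..2 * X, cutoff m x * sawtoothTail H (√((x ^ 2) ^ 2 - (m : ℝ) ^ 2)) ^ 2 ≤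
      ⌈(2 * X) ^ 2⌉₊ * (H : ℝ)⁻¹ := by
  obtain ⟨B, hB⟩ := exists_abs_sawtoothTail_le H
  have hint : ∀ u v, IntervalIntegrable (fun t => sawtoothTail H t ^ 2) volume u v :=
    intervalIntegrable_of_measurable_of_abs_le (B := B ^ 2) ((measurable_sawtoothTail H).pow_const 2)
      fun t => by
        rw [abs_pow]
        exact pow_le_pow_left₀ (abs_nonneg _) (hB t) 2
  have hma : (m : ℝ) ≤ (max X √m) ^ 2 := by
    calc (m : ℝ) = √m ^ 2 := (sq_sqrt (Nat.cast_nonneg m)).symm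
      _ ≤ _ := by gcongr; exact le_max_right _ _
  rw [integral_cutoff_mul (by linarith) hm]
  refine (integral_periodic_comp_sqrt_le (fun t => by rw [periodic_sawtoothTail H t])
    (fun t => sq_nonneg (sawtoothTail H t)) hint (hX.trans (le_max_left _ _))
    (max_le (by linarith) ((sqrt_le_left (by linarith)).2 hm)) (Nat.cast_nonneg m) hma).trans ?_
  gcongr
  exact integral_sawtoothTail_sq_le hH

lemma T_sq_eq_sum_cutoff {N : ℕ} {x : ℝ} (hx : ⌊x ^ 2⌋₊ ≤ N) :
    T (x ^ 2) = ∑ m ∈ Finset.range (N + 1),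
      (r2 m : ℝ) * (cutoff m x * sawtooth (√((x ^ 2) ^ 2 - (m : ℝ) ^ 2))) := by
  have hsub : Finset.Iic ⌊x ^ 2⌋₊ ⊆ Finset.range (N + 1) := fun m hm => by
    have := Finset.mem_Iic.1 hm
    exact Finset.mem_range.2 (by omega)
  unfold T
  rw [← Finset.sum_subset hsub]
  · refine Finset.sum_congr rfl fun m hm => ?_
    have : (m : ℝ) ≤ x ^ 2 := (Nat.le_floor_iff (sq_nonneg x)).1 (Finset.mem_Iic.1 hm)
    rw [cutoff, if_pos this, one_mul]
  · intro m _ hm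
    have : ¬ (m : ℝ) ≤ x ^ 2 := fun h =>
      hm (Finset.mem_Iic.2 ((Nat.le_floor_iff (sq_nonneg x)).2 h))
    rw [cutoff, if_neg this, zero_mul, mul_zero]

/-- Truncated Fourier expansion and Cauchy–Schwarz in the frequency. -/
lemma T_sq_le {N : ℕ} {x : ℝ} (hx : ⌊x ^ 2⌋₊ ≤ N) (H : ℕ) :
    T (x ^ 2) ^ 2 ≤
      2 * ((∑ m ∈ Finset.range (N + 1), (r2 m : ℝ) ^ 2) *
        ∑ m ∈ Finset.range (N + 1),
          cutoff m x * sawtoothTail H (√((x ^ 2) ^ 2 - (m : ℝ) ^ 2)) ^ 2) +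
      2 * ((∑ h ∈ Finset.Icc 1 H, (h : ℝ)⁻¹) *
        ∑ h ∈ Finset.Icc 1 H, (h : ℝ)⁻¹ * normSqExpSum h N x) := by
  set E := ∑ m ∈ Finset.range (N + 1),
    (r2 m : ℝ) * (cutoff m x * sawtoothTail H (√((x ^ 2) ^ 2 - (m : ℝ) ^ 2))) with hE
  set s : ℕ → ℝ := fun h => ∑ m ∈ Finset.range (N + 1), (r2 m : ℝ) * cutoff m x *
    sin (2 * π * h * √((x ^ 2) ^ 2 - (m : ℝ) ^ 2)) with hs
  set F := ∑ h ∈ Finset.Icc 1 H, s h / h with hF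
  have hT : T (x ^ 2) = E - F / π := by
    rw [T_sq_eq_sum_cutoff hx, hE, hF, Finset.sum_div]
    simp only [hs, Finset.sum_div]
    rw [Finset.sum_comm, ← Finset.sum_sub_distrib]
    refine Finset.sum_congr rfl fun m _ => ?_
    rw [sawtoothTail, mul_add, mul_add, Finset.mul_sum, Finset.mul_sum, add_sub_assoc,
      ← Finset.sum_sub_distrib, Finset.sum_eq_zero, add_zero]
    intro h _
    rw [div_div, mul_comm π]
    ring
  have hE2 : E ^ 2 ≤ (∑ m ∈ Finset.range (N + 1), (r2 m : ℝ) ^ 2) *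
      ∑ m ∈ Finset.range (N + 1),
        cutoff m x * sawtoothTail H (√((x ^ 2) ^ 2 - (m : ℝ) ^ 2)) ^ 2 := by
    refine (Finset.sum_mul_sq_le_sq_mul_sq _ _ _).trans_eq ?_
    simp_rw [mul_pow, cutoff_sq]
  have hF2 : F ^ 2 ≤ (∑ h ∈ Finset.Icc 1 H, (h : ℝ)⁻¹) *
      ∑ h ∈ Finset.Icc 1 H, (h : ℝ)⁻¹ * normSqExpSum h N x := by
    refine Finset.sum_sq_le_sum_mul_sum_of_sq_le_mul _ (fun h _ => by positivity)
      (fun h _ => mul_nonneg (by positivity)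
        ((sq_nonneg _).trans (sq_sum_sin_le_normSqExpSum h N x))) fun h _ => ?_
    rw [div_pow, div_eq_mul_inv, mul_comm, ← mul_assoc, ← sq, inv_pow]
    exact mul_le_mul_of_nonneg_left (sq_sum_sin_le_normSqExpSum h N x) (by positivity)
  have hFpi : (F / π) ^ 2 ≤ F ^ 2 := by
    rw [div_pow]
    exact div_le_self (sq_nonneg F) (one_le_pow₀ (by linarith [pi_gt_three]))
  rw [hT]
  nlinarith [sq_nonneg (E + F / π)]

lemma integral_T_sq_le {X : ℝ} (hX : 1 ≤ X) {H N : ℕ} (hH : H ≠ 0)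
    (hN : N = ⌊(2 * X) ^ 2⌋₊) :
    ∫ x in X..2 * X, T (x ^ 2) ^ 2 ≤
      2 * ((∑ m ∈ Finset.range (N + 1), (r2 m : ℝ) ^ 2) *
        ((N + 1) * (⌈(2 * X) ^ 2⌉₊ * (H : ℝ)⁻¹))) +
      2 * ((∑ h ∈ Finset.Icc 1 H, (h : ℝ)⁻¹) * ∑ h ∈ Finset.Icc 1 H, (h : ℝ)⁻¹ *
        (X * ∑ m ∈ Finset.range (N + 1), (r2 m : ℝ) ^ 2 +
          16 * X ^ 3 / h * ∑ m ∈ Finset.range (N + 1), ∑ n ∈ (Finset.range (N + 1)).erase m,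
            (r2 m : ℝ) * r2 n / |(m : ℝ) ^ 2 - (n : ℝ) ^ 2|)) := by
  have hNle : (N : ℝ) ≤ (2 * X) ^ 2 := by
    rw [hN]
    exact Nat.floor_le (by positivity)
  obtain ⟨B, hB⟩ := exists_abs_sawtoothTail_le H
  have htail : ∀ m : ℕ, IntervalIntegrable
      (fun x => cutoff m x * sawtoothTail H (√((x ^ 2) ^ 2 - (m : ℝ) ^ 2)) ^ 2)
      volume X (2 * X) := by
    intro m
    refine intervalIntegrable_of_measurable_of_abs_le (B := 1 * B ^ 2) ?_ (fun x => ?_) _ _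
    · exact (measurable_cutoff m).mul
        (((measurable_sawtoothTail H).comp (by fun_prop)).pow_const 2)
    · rw [abs_mul, abs_of_nonneg (cutoff_nonneg m x), abs_pow]
      gcongr
      · exact cutoff_le_one m x
      · exact hB _
  have htailsum : IntervalIntegrable (fun x => ∑ m ∈ Finset.range (N + 1),
      cutoff m x * sawtoothTail H (√((x ^ 2) ^ 2 - (m : ℝ) ^ 2)) ^ 2) volume X (2 * X) := by
    simpa only [Finset.sum_fn] using IntervalIntegrable.sum (Finset.range (N + 1))
      fun m _ => htail m
  have hnorm : ∀ h : ℕ, IntervalIntegrable (fun x => (h : ℝ)⁻¹ * normSqExpSum h N x)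
      volume X (2 * X) := fun h => (intervalIntegrable_normSqExpSum h N _ _).const_mul _
  have hnormsum : IntervalIntegrable (fun x => ∑ h ∈ Finset.Icc 1 H,
      (h : ℝ)⁻¹ * normSqExpSum h N x) volume X (2 * X) := by
    simpa only [Finset.sum_fn] using IntervalIntegrable.sum (Finset.Icc 1 H) fun h _ => hnorm h
  have hmajor := ((htailsum.const_mul (∑ m ∈ Finset.range (N + 1), (r2 m : ℝ) ^ 2)).const_mul
    2).add ((hnormsum.const_mul (∑ h ∈ Finset.Icc 1 H, (h : ℝ)⁻¹)).const_mul 2)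
  have hle : X ≤ 2 * X := by linarith
  have hmono : ∫ x in X..2 * X, T (x ^ 2) ^ 2 ≤ ∫ x in X..2 * X,
      (2 * ((∑ m ∈ Finset.range (N + 1), (r2 m : ℝ) ^ 2) *
        ∑ m ∈ Finset.range (N + 1),
          cutoff m x * sawtoothTail H (√((x ^ 2) ^ 2 - (m : ℝ) ^ 2)) ^ 2) +
      2 * ((∑ h ∈ Finset.Icc 1 H, (h : ℝ)⁻¹) *
        ∑ h ∈ Finset.Icc 1 H, (h : ℝ)⁻¹ * normSqExpSum h N x)) := by
    rw [intervalIntegral.integral_of_le hle, intervalIntegral.integral_of_le hle]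
    refine integral_mono_of_nonneg (Filter.Eventually.of_forall fun x => sq_nonneg _)
      ((intervalIntegrable_iff_integrableOn_Ioc_of_le hle).1 hmajor) ?_
    refine (ae_restrict_mem measurableSet_Ioc).mono fun x hx => T_sq_le ?_ H
    rw [hN]
    have : 0 ≤ x := by linarith [hx.1]
    gcongr
    exact hx.2
  refine hmono.trans ?_
  rw [intervalIntegral.integral_add ((htailsum.const_mul _).const_mul 2)
    ((hnormsum.const_mul _).const_mul 2)]
  simp_rw [intervalIntegral.integral_const_mul]
  rw [intervalIntegral.integral_finsetSum fun m _ => htail m,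
    intervalIntegral.integral_finsetSum fun h _ => hnorm h]
  simp_rw [intervalIntegral.integral_const_mul]
  gcongr with h hh
  · have hbound : ∀ m ∈ Finset.range (N + 1),
        ∫ x in X..2 * X, cutoff m x * sawtoothTail H (√((x ^ 2) ^ 2 - (m : ℝ) ^ 2)) ^ 2 ≤
          ⌈(2 * X) ^ 2⌉₊ * (H : ℝ)⁻¹ := fun m hm =>
      integral_cutoff_mul_sawtoothTail_sq_le hX hH
        (le_trans (by exact_mod_cast Nat.lt_succ_iff.1 (Finset.mem_range.1 hm)) hNle)
    simpa using Finset.sum_le_sum hbound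
  · have : h ≠ 0 := by
      have := (Finset.mem_Icc.1 hh).1
      omega
    exact integral_normSqExpSum_le (by linarith) this hNle

lemma sum_Icc_inv_sq_le_two (H : ℕ) : ∑ h ∈ Finset.Icc 1 H, ((h : ℝ) ^ 2)⁻¹ ≤ 2 := by
  have h := sum_le_hasSum (Finset.Icc 1 H) (fun i _ => by positivity) hasSum_zeta_two
  simp_rw [one_div] at h
  have hpi : π ^ 2 ≤ 12 := by nlinarith [pi_lt_d2, pi_gt_three]
  linarith

lemma integral_T_sq_le_log {X : ℝ} (hX : 1 ≤ X) :
    ∫ x in X..2 * X, T (x ^ 2) ^ 2 ≤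
      4000000 * X ^ 3 * (1 + log (⌊(2 * X) ^ 2⌋₊ + 1)) ^ 4 := by
  set N := ⌊(2 * X) ^ 2⌋₊ with hN
  set l := 1 + log ((N : ℝ) + 1) with hl
  have hN0 : (0 : ℝ) ≤ N := Nat.cast_nonneg N
  have hl1 : 1 ≤ l := by linarith [log_nonneg (by linarith : (1 : ℝ) ≤ N + 1)]
  have hNlower : 4 * X ^ 2 ≤ (N : ℝ) + 1 := by nlinarith [Nat.lt_floor_add_one ((2 * X) ^ 2)]
  have hNupper : (N : ℝ) + 1 ≤ 5 * X ^ 2 := by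
    nlinarith [Nat.floor_le (by positivity : 0 ≤ (2 * X) ^ 2)]
  have hceil : (⌈(2 * X) ^ 2⌉₊ : ℝ) ≤ 5 * X ^ 2 := by
    nlinarith [Nat.ceil_lt_add_one (by positivity : 0 ≤ (2 * X) ^ 2)]
  have hQ : ∑ m ∈ Finset.range (N + 1), (r2 m : ℝ) ^ 2 ≤ 14580 * X ^ 2 * l :=
    (sum_r2_sq_le N).trans (by nlinarith)
  have hQ0 : 0 ≤ ∑ m ∈ Finset.range (N + 1), (r2 m : ℝ) ^ 2 := by positivity
  have hD := sum_r2_mul_r2_div_abs_sq_sub_sq_le N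
  have hmain := integral_T_sq_le hX (H := (N + 1) ^ 2) (by positivity) hN
  have hharm : ∑ h ∈ Finset.Icc (1 : ℕ) ((N + 1) ^ 2), (h : ℝ)⁻¹ ≤ 2 * l := by
    refine (sum_Icc_inv_le_one_add_log _).trans ?_
    push_cast
    rw [log_pow]
    push_cast
    linarith
  have hsq := sum_Icc_inv_sq_le_two ((N + 1) ^ 2)
  set Q := ∑ m ∈ Finset.range (N + 1), (r2 m : ℝ) ^ 2
  set D := ∑ m ∈ Finset.range (N + 1), ∑ n ∈ (Finset.range (N + 1)).erase m,
      (r2 m : ℝ) * r2 n / |(m : ℝ) ^ 2 - (n : ℝ) ^ 2|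
  have hD0 : 0 ≤ D := by positivity
  have htail : ((N : ℝ) + 1) * (⌈(2 * X) ^ 2⌉₊ * (((N + 1) ^ 2 : ℕ) : ℝ)⁻¹) ≤ 5 / 4 := by
    push_cast
    calc ((N : ℝ) + 1) * (⌈(2 * X) ^ 2⌉₊ * (((N : ℝ) + 1) ^ 2)⁻¹)
        = ⌈(2 * X) ^ 2⌉₊ / ((N : ℝ) + 1) := by field_simp
      _ ≤ 5 / 4 := by
        rw [div_le_iff₀ (by linarith)]
        linarith
  have hfreq : ∑ h ∈ Finset.Icc (1 : ℕ) ((N + 1) ^ 2), (h : ℝ)⁻¹ * (X * Q + 16 * X ^ 3 / h * D) ≤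
      2 * l * (X * Q) + 2 * (16 * X ^ 3 * D) := by
    calc _ = (∑ h ∈ Finset.Icc (1 : ℕ) ((N + 1) ^ 2), (h : ℝ)⁻¹) * (X * Q) +
          (∑ h ∈ Finset.Icc (1 : ℕ) ((N + 1) ^ 2), ((h : ℝ) ^ 2)⁻¹) * (16 * X ^ 3 * D) := by
          rw [Finset.sum_mul, Finset.sum_mul, ← Finset.sum_add_distrib]
          refine Finset.sum_congr rfl fun h _ => ?_
          ring
      _ ≤ _ := by gcongr
  have hl3 : l ≤ l ^ 4 := le_self_pow₀ hl1 (by norm_num)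
  have hl34 : l ^ 3 ≤ l ^ 4 := pow_le_pow_right₀ hl1 (by norm_num)
  have hX23 : X ^ 2 ≤ X ^ 3 := pow_le_pow_right₀ hX (by norm_num)
  calc _ ≤ 2 * (Q * (5 / 4)) + 2 * (2 * l * (2 * l * (X * Q) + 2 * (16 * X ^ 3 * D))) := by
        refine hmain.trans ?_
        gcongr
    _ ≤ 2 * (14580 * X ^ 2 * l * (5 / 4)) + 2 * (2 * l * (2 * l * (X * (14580 * X ^ 2 * l)) +
          2 * (16 * X ^ 3 * (23328 * l ^ 3)))) := by gcongr
    _ = 36450 * (X ^ 2 * l) + 116640 * (X ^ 3 * l ^ 3) + 2985984 * (X ^ 3 * l ^ 4) := by ring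
    _ ≤ 36450 * (X ^ 3 * l ^ 4) + 116640 * (X ^ 3 * l ^ 4) + 2985984 * (X ^ 3 * l ^ 4) := by
        gcongr
    _ ≤ 4000000 * X ^ 3 * l ^ 4 := by nlinarith [(by positivity : 0 ≤ X ^ 3 * l ^ 4)]

theorem stmt_13 :
    ∃ C : ℝ, 0 < C ∧ ∀ X : ℝ, 2 ≤ X →
      (1 / X) * ∫ x in X..(2 * X), (T (x ^ 2)) ^ 2 ≤ C * X ^ 2 * (Real.log X) ^ 4 := by
  refine ⟨4000000 * 12 ^ 4, by norm_num, fun X hX => ?_⟩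
  have hX0 : 0 < X := by linarith
  have hlogX : 1 / 2 ≤ log X := by
    have := log_le_log two_pos hX
    linarith [log_two_gt_d9]
  have hlog : 1 + log ((⌊(2 * X) ^ 2⌋₊ : ℝ) + 1) ≤ 12 * log X := by
    have hle : (⌊(2 * X) ^ 2⌋₊ : ℝ) + 1 ≤ 5 * X ^ 2 := by
      nlinarith [Nat.floor_le (by positivity : 0 ≤ (2 * X) ^ 2)]
    have h1 := log_le_log (by positivity) hle
    rw [log_mul (by norm_num) (by positivity), log_pow] at h1
    have h5 := log_le_sub_one_of_pos (by norm_num : (0 : ℝ) < 5)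
    push_cast at h1
    linarith
  have hlog0 : 0 ≤ log ((⌊(2 * X) ^ 2⌋₊ : ℝ) + 1) :=
    log_nonneg (by linarith [Nat.cast_nonneg (α := ℝ) ⌊(2 * X) ^ 2⌋₊])
  calc 1 / X * ∫ x in X..2 * X, T (x ^ 2) ^ 2
      ≤ 1 / X * (4000000 * X ^ 3 * (12 * log X) ^ 4) := by
        refine mul_le_mul_of_nonneg_left ((integral_T_sq_le_log (by linarith)).trans ?_)
          (by positivity)
        gcongr
    _ = 4000000 * 12 ^ 4 * X ^ 2 * log X ^ 4 := by
        field_simp
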